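/- arXiv:2109.14999 — 7 statements merged into one kernel-verified Lean document; each statement's English description precedes it below -/
import Mathlib

section
/- Let N ≥ 1 and let B = (b_{i,j}) be a real symmetric N×N matrix. Then for every integer r ≥ 0, the trace of B^(2^r) satisfies tr(B^(2^r)) ≥ Σ_{i=1}^N (b_{i,i})^(2^r). -/
/-- The square of a diagonal entry of a real symmetric matrix is at most the corresponding diagonal
entry of its square. -/
theorem Matrix.IsSymm.diag_sq_le {n : Type*} [Fintype n] [DecidableEq n] {B : Matrix n n ℝ}
    (hB : B.IsSymm) (i : n) : B i i ^ 2 ≤ (B ^ 2) i i := by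
  rw [sq B, Matrix.mul_apply, sq]
  refine Finset.single_le_sum (f := fun j => B i j * B j i) (fun j _ => ?_) (Finset.mem_univ i)
  rw [hB.apply i j]
  exact mul_self_nonneg _

/-- The `2 ^ r`-th power of a diagonal entry of a real symmetric matrix is at most the
corresponding diagonal entry of the `2 ^ r`-th power of the matrix. -/
theorem Matrix.IsSymm.diag_pow_two_pow_le {n : Type*} [Fintype n] [DecidableEq n]
    {B : Matrix n n ℝ} (hB : B.IsSymm) (r : ℕ) (i : n) :
    B i i ^ 2 ^ r ≤ (B ^ 2 ^ r) i i := by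
  induction r generalizing B with
  | zero => simp
  | succ r ih =>
    rw [pow_succ' 2 r, pow_mul, pow_mul]
    exact (pow_le_pow_left₀ (sq_nonneg _) (hB.diag_sq_le i) _).trans (ih (hB.pow 2))

/-- For a real symmetric `N × N` matrix `B` (`N ≥ 1`) and every
integer `r ≥ 0`, `tr(B^(2^r)) ≥ ∑ i, (B i i)^(2^r)`. -/
theorem trace_pow_two_pow_ge_sum_diag_pow
    (N : ℕ) (hN : 1 ≤ N) (B : Matrix (Fin N) (Fin N) ℝ) (hB : B.IsSymm) (r : ℕ) :
    ∑ i, (B i i) ^ (2 ^ r) ≤ (B ^ (2 ^ r)).trace := by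
  exact Finset.sum_le_sum fun i _ => hB.diag_pow_two_pow_le r i
end

section
/- Let N ≥ 2 and let B = (b_{i,j}) be a real symmetric N×N matrix such that the all-ones vector (1,...,1)^T is an eigenvector of B with eigenvalue 0. Then for every integer r ≥ 0, tr(B^(2^r)) ≥ (N/(N−1))^(2^r − 1) · Σ_{i=1}^N (b_{i,i})^(2^r). -/
theorem Matrix.IsSymm.mul_sq_diag_le_sq_diag_of_mulVec_one_eq_zero
    {N : ℕ} (hN : 2 ≤ N) {B : Matrix (Fin N) (Fin N) ℝ} (hB : B.IsSymm)
    (hOne : B.mulVec (fun _ => (1 : ℝ)) = 0) (i : Fin N) :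
    (N : ℝ) / ((N : ℝ) - 1) * (B i i) ^ 2 ≤ (B ^ 2) i i := by
  have hN' : (2 : ℝ) ≤ N := by exact_mod_cast hN
  have hrow : ∑ j, B i j = 0 := by
    simpa [Matrix.mulVec, dotProduct] using congrFun hOne i
  have hdiag : (B ^ 2) i i = ∑ j, B i j ^ 2 := by
    rw [pow_two, Matrix.mul_apply]
    exact Finset.sum_congr rfl fun j _ => by rw [hB.apply i j, pow_two]
  have hcs := sq_sum_le_card_mul_sum_sq (s := Finset.univ.erase i) (f := fun j => B i j)
  rw [Finset.card_erase_of_mem (Finset.mem_univ i), Finset.card_univ, Fintype.card_fin,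
    Nat.cast_sub (by omega), Nat.cast_one] at hcs
  rw [← Finset.add_sum_erase _ _ (Finset.mem_univ i)] at hrow hdiag
  rw [eq_neg_of_add_eq_zero_right hrow, neg_sq] at hcs
  rw [hdiag, div_mul_eq_mul_div, div_le_iff₀ (by linarith)]
  linarith

/-- For a real symmetric `N × N` matrix `B` (`N ≥ 2`) having the
all-ones vector as an eigenvector with eigenvalue `0`, for every integer `r ≥ 0`,
`tr(B^(2^r)) ≥ (N/(N-1))^(2^r - 1) · ∑ i, (B i i)^(2^r)`. -/
theorem trace_pow_two_pow_ge_of_ones_eigenvector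
    (N : ℕ) (hN : 2 ≤ N) (B : Matrix (Fin N) (Fin N) ℝ) (hB : B.IsSymm)
    (hOne : B.mulVec (fun _ => (1 : ℝ)) = 0) (r : ℕ) :
    ((N : ℝ) / ((N : ℝ) - 1)) ^ (2 ^ r - 1) * ∑ i, (B i i) ^ (2 ^ r)
      ≤ (B ^ (2 ^ r)).trace := by
  have hN' : (2 : ℝ) ≤ N := by exact_mod_cast hN
  have hc : (0 : ℝ) ≤ (N : ℝ) / ((N : ℝ) - 1) := div_nonneg (by linarith) (by linarith)
  induction r generalizing B with
  | zero => simp [Matrix.trace]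
  | succ r ih =>
    have hOne2 : (B ^ 2).mulVec (fun _ => (1 : ℝ)) = 0 := by
      rw [pow_two, ← Matrix.mulVec_mulVec, hOne, Matrix.mulVec_zero]
    have hexp : 2 ^ (r + 1) - 1 = (2 ^ r - 1) + 2 ^ r := by
      have := Nat.one_le_two_pow (n := r)
      omega
    calc ((N : ℝ) / ((N : ℝ) - 1)) ^ (2 ^ (r + 1) - 1) * ∑ i, (B i i) ^ (2 ^ (r + 1))
        = ((N : ℝ) / ((N : ℝ) - 1)) ^ (2 ^ r - 1) *
            ∑ i, ((N : ℝ) / ((N : ℝ) - 1) * (B i i) ^ 2) ^ (2 ^ r) := by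
          simp_rw [hexp, mul_pow, ← Finset.mul_sum, ← pow_mul, ← pow_succ']
          ring
      _ ≤ ((N : ℝ) / ((N : ℝ) - 1)) ^ (2 ^ r - 1) * ∑ i, ((B ^ 2) i i) ^ (2 ^ r) := by
          gcongr with i
          exact hB.mul_sq_diag_le_sq_diag_of_mulVec_one_eq_zero hN hOne i
      _ ≤ ((B ^ 2) ^ (2 ^ r)).trace := ih (B ^ 2) (hB.pow 2) hOne2
      _ = (B ^ (2 ^ (r + 1))).trace := by rw [← pow_mul, ← pow_succ']
end

section
/- Let N ≥ 2 and let z_{1,N} > z_{2,N} > ... > z_{N,N} be the ordered roots of the Hermite polynomial H_N. Then for every i ∈ {1,...,N}, ( Σ_{l ≠ i} 1/(z_{i,N} − z_{l,N})² )² + Σ_{l ≠ i} 1/(z_{i,N} − z_{l,N})⁴ ≤ (N−1)³/N. -/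
/-- The physicists' Hermite polynomials, orthogonal w.r.t. the weight `exp(-x²)` on `ℝ`:
`H_0 = 1`, `H_1 = 2X`, `H_{n+2} = 2X·H_{n+1} - 2(n+1)·H_n`. -/
noncomputable def hermiteP : ℕ → Polynomial ℝ
  | 0 => 1
  | 1 => 2 * Polynomial.X
  | n + 2 => 2 * Polynomial.X * hermiteP (n + 1) - Polynomial.C (2 * ((n : ℝ) + 1)) * hermiteP n

open Polynomial in
theorem hermiteP_natDegree_le_and_coeff (n : ℕ) :
    (hermiteP n).natDegree ≤ n ∧ (hermiteP n).coeff n = 2 ^ n := by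
  induction n using hermiteP.induct with
  | case1 => simp [hermiteP]
  | case2 =>
    have h : (2 * X : ℝ[X]) = C 2 * X := rfl
    rw [hermiteP, h]
    exact ⟨(natDegree_C_mul_le _ _).trans natDegree_X_le, by simp⟩
  | case3 n ih1 ih0 =>
    have h : hermiteP (n + 2)
        = C 2 * (X * hermiteP (n + 1)) - C (2 * ((n : ℝ) + 1)) * hermiteP n := by
      rw [hermiteP, show (C 2 : ℝ[X]) = 2 from rfl]
      ring
    constructor
    · rw [h]
      refine (natDegree_sub_le _ _).trans (max_le ?_ ?_)
      · refine (natDegree_C_mul_le _ _).trans (natDegree_mul_le.trans ?_)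
        have := ih1.1
        rw [natDegree_X]
        omega
      · exact (natDegree_C_mul_le _ _).trans (ih0.1.trans (by omega))
    · have h0 : (hermiteP n).coeff (n + 2) = 0 :=
        coeff_eq_zero_of_natDegree_lt (by have := ih0.1; omega)
      rw [h, coeff_sub, coeff_C_mul, coeff_C_mul, coeff_X_mul, ih1.2, h0, pow_succ, pow_succ]
      ring

open Polynomial in
theorem derivative_hermiteP_succ (n : ℕ) :
    derivative (hermiteP (n + 1)) = C (2 * ((n : ℝ) + 1)) * hermiteP n := by
  induction n using Nat.strong_induction_on with
  | _ n ih =>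
    match n with
    | 0 => simp [hermiteP, show (C 2 : ℝ[X]) = 2 from rfl]
    | 1 =>
      simp [hermiteP, show (C 2 : ℝ[X]) = 2 from rfl]
      ring
    | n + 2 =>
      have h1 := ih (n + 1) (by omega)
      have h0 := ih n (by omega)
      rw [hermiteP, derivative_sub, derivative_mul, derivative_mul, derivative_mul, h1,
        derivative_C, h0, hermiteP]
      simp only [derivative_X, derivative_ofNat, Nat.cast_add, Nat.cast_one, Nat.cast_ofNat,
        C_mul, C_add, C_1, show (C 2 : ℝ[X]) = 2 from rfl]
      ring

open Polynomial in
/-- The Hermite differential equation for `hermiteP n`. -/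
theorem derivative_derivative_hermiteP (n : ℕ) :
    derivative (derivative (hermiteP n))
      = 2 * X * derivative (hermiteP n) - C (2 * (n : ℝ)) * hermiteP n := by
  match n with
  | 0 => simp [hermiteP]
  | 1 =>
    simp [hermiteP, show (C 2 : ℝ[X]) = 2 from rfl]
    ring
  | n + 2 =>
    have h1 := derivative_hermiteP_succ (n + 1)
    have h0 := derivative_hermiteP_succ n
    rw [h1, derivative_C_mul, h0, hermiteP]
    simp only [Nat.cast_add, Nat.cast_one, Nat.cast_ofNat,
        C_mul, C_add, C_1, show (C 2 : ℝ[X]) = 2 from rfl]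
    ring

open Polynomial in
theorem hermiteP_eq_C_mul_prod (N : ℕ) (z : Fin N → ℝ) (hz : Function.Injective z)
    (hroot : ∀ i, (hermiteP N).eval (z i) = 0) :
    ∃ c : ℝ, c ≠ 0 ∧ hermiteP N = C c * ∏ i, (X - C (z i)) := by
  obtain ⟨hdeg, hcoeff⟩ := hermiteP_natDegree_le_and_coeff N
  have hne : hermiteP N ≠ 0 := by
    intro h
    rw [h, coeff_zero] at hcoeff
    exact pow_ne_zero N two_ne_zero hcoeff.symm
  have hdvd : ∏ i, (X - C (z i)) ∣ hermiteP N :=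
    Finset.prod_dvd_of_coprime (fun i _ j _ hij => pairwise_coprime_X_sub_C hz hij)
      fun i _ => dvd_iff_isRoot.2 (hroot i)
  obtain ⟨q, hq⟩ := hdvd
  have hq0 : q ≠ 0 := by
    rintro rfl
    exact hne (by simpa using hq)
  have hmonic : (∏ i, (X - C (z i))).Monic := monic_prod_of_monic _ _ fun i _ => monic_X_sub_C _
  have hqdeg : q.natDegree = 0 := by
    have h := hmonic.natDegree_mul' hq0
    rw [← hq, natDegree_finsetProd_X_sub_C_eq_card] at h
    simp only [Finset.card_univ, Fintype.card_fin] at h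
    omega
  rw [eq_C_of_natDegree_eq_zero hqdeg] at hq hq0
  exact ⟨_, by simpa using hq0, by rw [hq, mul_comm]⟩

open Polynomial in
/-- The first four derivatives of a product of linear factors at a point `x` that is not a root,
in terms of the power sums of `1 / (x - z l)`. -/
theorem eval_derivatives_prod_X_sub_C {ι : Type*} (s : Finset ι) (z : ι → ℝ) (x : ℝ)
    (hx : ∀ l ∈ s, x ≠ z l) :
    let g : ℝ[X] := ∏ l ∈ s, (X - C (z l))
    let p : ℕ → ℝ := fun k => ∑ l ∈ s, ((x - z l) ^ k)⁻¹
    g.eval x ≠ 0 ∧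
    (derivative g).eval x = g.eval x * p 1 ∧
    (derivative^[2] g).eval x = g.eval x * (p 1 ^ 2 - p 2) ∧
    (derivative^[3] g).eval x = g.eval x * (p 1 ^ 3 - 3 * p 1 * p 2 + 2 * p 3) ∧
    (derivative^[4] g).eval x
      = g.eval x * (p 1 ^ 4 - 6 * p 1 ^ 2 * p 2 + 3 * p 2 ^ 2 + 8 * p 1 * p 3 - 6 * p 4) := by
  classical
  induction s using Finset.induction_on with
  | empty => simp
  | insert a s ha ih =>
    replace ih := ih fun l hl => hx l (Finset.mem_insert_of_mem hl)
    dsimp only at ih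
    obtain ⟨h0, h1, h2, h3, h4⟩ := ih
    have hxa : x - z a ≠ 0 := sub_ne_zero.2 (hx a (Finset.mem_insert_self _ _))
    simp only [Finset.prod_insert ha, Finset.sum_insert ha]
    generalize ∏ l ∈ s, (X - C (z l)) = g at *
    generalize (∑ l ∈ s, ((x - z l) ^ 1)⁻¹) = p1 at *
    generalize (∑ l ∈ s, ((x - z l) ^ 2)⁻¹) = p2 at *
    generalize (∑ l ∈ s, ((x - z l) ^ 3)⁻¹) = p3 at *
    generalize (∑ l ∈ s, ((x - z l) ^ 4)⁻¹) = p4 at *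
    simp only [Function.iterate_succ, Function.iterate_zero, Function.comp, id] at *
    simp only [derivative_mul, derivative_add, derivative_sub, derivative_X, derivative_C,
      sub_zero, one_mul, eval_add, eval_mul,
      eval_sub, eval_X, eval_C, h1, h2, h3, h4]
    generalize eval x g = G at *
    generalize x - z a = d at *
    refine ⟨mul_ne_zero hxa h0, ?_, ?_, ?_, ?_⟩ <;> field_simp <;> ring

open Polynomial in
/-- The second and fourth inverse power sums of the differences between a root of the Hermite
polynomial and the other roots. -/
theorem hermiteP_roots_power_sums (N : ℕ) (z : Fin N → ℝ) (hz : Function.Injective z)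
    (hroot : ∀ i, (hermiteP N).eval (z i) = 0) (i : Fin N) :
    let t : ℝ := 2 * ((N : ℝ) - 1) - z i ^ 2
    ∑ l ∈ Finset.univ.erase i, ((z i - z l) ^ 2)⁻¹ = t / 3 ∧
    ∑ l ∈ Finset.univ.erase i, ((z i - z l) ^ 4)⁻¹ = (t ^ 2 + 6 * t) / 45 := by
  obtain ⟨c, hc, hfac⟩ := hermiteP_eq_C_mul_prod N z hz hroot
  have key := eval_derivatives_prod_X_sub_C (Finset.univ.erase i) z (z i)
    fun l hl h => (Finset.ne_of_mem_erase hl) (hz h).symm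
  dsimp only at key ⊢
  obtain ⟨h0, h1, h2, h3, h4⟩ := key
  rw [← Finset.mul_prod_erase _ _ (Finset.mem_univ i)] at hfac
  have ode := derivative_derivative_hermiteP N
  rw [hfac] at ode
  generalize ∏ l ∈ Finset.univ.erase i, (X - C (z l)) = g at *
  generalize (∑ l ∈ Finset.univ.erase i, ((z i - z l) ^ 1)⁻¹) = p1 at *
  generalize (∑ l ∈ Finset.univ.erase i, ((z i - z l) ^ 2)⁻¹) = p2 at *
  generalize (∑ l ∈ Finset.univ.erase i, ((z i - z l) ^ 3)⁻¹) = p3 at *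
  generalize (∑ l ∈ Finset.univ.erase i, ((z i - z l) ^ 4)⁻¹) = p4 at *
  simp only [Function.iterate_succ, Function.iterate_zero, Function.comp, id] at h2 h3 h4
  have ode1 := congrArg derivative ode
  have ode2 := congrArg derivative ode1
  have ode3 := congrArg derivative ode2
  apply_fun eval (z i) at ode ode1 ode2 ode3
  simp only [derivative_mul, derivative_add, derivative_sub, derivative_X, derivative_C,
      derivative_ofNat, sub_zero, one_mul, zero_mul, zero_add,
      mul_one, mul_zero, add_zero, eval_add, eval_mul, eval_ofNat, sub_self,
      eval_sub, eval_X, eval_C, h1, h2, h3, h4] at ode ode1 ode2 ode3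
  generalize eval (z i) g = G at *
  generalize z i = x at *
  have hcG : c * G ≠ 0 := mul_ne_zero hc h0
  have e1 : p1 = x := mul_left_cancel₀ hcG (by linear_combination ode / 2)
  subst e1
  have e2 : p2 = (2 * ((N : ℝ) - 1) - p1 ^ 2) / 3 :=
    mul_left_cancel₀ hcG (by linear_combination -ode1 / 3)
  subst e2
  have e3 : 4 * (p1 ^ 3 - p1 * (2 * ((N : ℝ) - 1) - p1 ^ 2) + 2 * p3)
      = 8 * p1 ^ 3 - 8 * ((N : ℝ) - 1) * p1 + 4 * p1 :=
    mul_left_cancel₀ hcG (by linear_combination ode2)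
  obtain rfl : p3 = (8 * p1 ^ 3 - 8 * ((N : ℝ) - 1) * p1 + 4 * p1
      - 4 * (p1 ^ 3 - p1 * (2 * ((N : ℝ) - 1) - p1 ^ 2))) / 8 := by linarith
  exact ⟨rfl, mul_left_cancel₀ hcG (by linear_combination -ode3 / 30)⟩

/-- For the ordered roots `z 0 > z 1 > … > z (N-1)` of the Hermite
polynomial `H_N` (`N ≥ 2`), for every `i`,
`(∑_{l ≠ i} 1/(z i - z l)²)² + ∑_{l ≠ i} 1/(z i - z l)⁴ ≤ (N-1)³/N`. -/
theorem hermite_roots_inequality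
    (N : ℕ) (hN : 2 ≤ N) (z : Fin N → ℝ) (hz : StrictAnti z)
    (hroot : ∀ i, (hermiteP N).eval (z i) = 0) (i : Fin N) :
    (∑ l ∈ Finset.univ.erase i, ((z i - z l) ^ 2)⁻¹) ^ 2
        + ∑ l ∈ Finset.univ.erase i, ((z i - z l) ^ 4)⁻¹
      ≤ ((N : ℝ) - 1) ^ 3 / N := by
  obtain ⟨h2, h4⟩ := hermiteP_roots_power_sums N z hz.injective hroot i
  have hp2 : 0 ≤ ∑ l ∈ Finset.univ.erase i, ((z i - z l) ^ 2)⁻¹ :=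
    Finset.sum_nonneg fun l _ => by positivity
  rw [h2] at hp2
  rw [h2, h4]
  rcases hN.eq_or_lt with rfl | hN3
  · have hx : z i ^ 2 = 1 / 2 := by
      have h := hroot i
      simp [hermiteP] at h
      linarith
    rw [hx]
    norm_num
  · have hN' : (3 : ℝ) ≤ N := by exact_mod_cast hN3
    rw [le_div_iff₀ (by linarith)]
    obtain ⟨t, ht⟩ : ∃ t, t = 2 * ((N : ℝ) - 1) - z i ^ 2 := ⟨_, rfl⟩
    rw [← ht] at hp2 ⊢
    have ht0 : 0 ≤ t := by linarith
    have htM : t ≤ 2 * ((N : ℝ) - 1) := by nlinarith [sq_nonneg (z i)]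
    have hM : 0 ≤ 2 * ((N : ℝ) - 1) := by linarith
    have hbound : t * (t + 1) ≤ 2 * ((N : ℝ) - 1) * (2 * ((N : ℝ) - 1) + 1) := by gcongr
    have hpoly : 0 ≤ ((N : ℝ) - 1) * ((N : ℝ) - 3) * (7 * ((N : ℝ) - 1) + 2) :=
      mul_nonneg (mul_nonneg (by linarith) (by linarith)) (by linarith)
    calc ((t / 3) ^ 2 + (t ^ 2 + 6 * t) / 45) * N = 2 / 15 * N * (t * (t + 1)) := by ring
      _ ≤ 2 / 15 * N * (2 * ((N : ℝ) - 1) * (2 * ((N : ℝ) - 1) + 1)) := by gcongr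
      _ ≤ ((N : ℝ) - 1) ^ 3 := by linear_combination hpoly / 15
end

section
/- Let N ≥ 2 and let z_{1,N} > z_{2,N} > ... > z_{N,N} be the ordered roots of the Hermite polynomial H_N. Then for every i ∈ {1,...,N}, Σ_{l ≠ i} 1/(z_{i,N} − z_{l,N})² ≤ (N−1)^{3/2}/N^{1/2} ≤ N−1. -/
open Polynomial in
theorem hermiteP_succ (n : ℕ) :
    hermiteP (n + 1) = 2 * X * hermiteP n - derivative (hermiteP n) := by
  cases n with
  | zero => simp [hermiteP]
  | succ n => rw [derivative_hermiteP_succ, hermiteP]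

open Polynomial in
theorem hermiteP_ne_zero (n : ℕ) : hermiteP n ≠ 0 := by
  induction n with
  | zero => simp [hermiteP]
  | succ n ih =>
    intro h
    have h' := derivative_hermiteP_succ n
    rw [h, derivative_zero] at h'
    have hc : (2 * ((n : ℝ) + 1)) ≠ 0 := by positivity
    exact mul_ne_zero (C_ne_zero.mpr hc) ih h'.symm

open Polynomial in
theorem natDegree_hermiteP_le (n : ℕ) : (hermiteP n).natDegree ≤ n := by
  induction n with
  | zero => simp [hermiteP]
  | succ n ih =>
    rw [hermiteP_succ]
    refine (natDegree_sub_le _ _).trans (max_le ?_ ?_)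
    · have h2 : (2 * X : ℝ[X]).natDegree ≤ 1 := by compute_degree
      exact natDegree_mul_le.trans (by omega)
    · exact (natDegree_derivative_le _).trans (by omega)

open Polynomial in
theorem Polynomial.eq_C_mul_prod_X_sub_C {K : Type*} [Field K] {n : ℕ} {p : K[X]} (hp : p ≠ 0)
    (hdeg : p.natDegree ≤ n) {z : Fin n → K} (hz : Function.Injective z)
    (hroot : ∀ i, p.eval (z i) = 0) :
    ∃ c : K, c ≠ 0 ∧ p = C c * ∏ i, (X - C (z i)) := by
  have hdvd : ∏ i, (X - C (z i)) ∣ p :=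
    Finset.prod_dvd_of_coprime
      (fun i _ j _ hij => pairwise_coprime_X_sub_C hz hij)
      (fun i _ => dvd_iff_isRoot.mpr (hroot i))
  obtain ⟨g, hg⟩ := hdvd
  have hg0 : g ≠ 0 := by
    rintro rfl
    exact hp (by simpa using hg)
  have hmonic : (∏ i, (X - C (z i))).Monic := monic_prod_X_sub_C z Finset.univ
  have hd : p.natDegree = n + g.natDegree := by
    rw [hg, hmonic.natDegree_mul' hg0]
    simp
  have hgC : g = C (g.coeff 0) := eq_C_of_natDegree_eq_zero (by omega)
  refine ⟨g.coeff 0, fun h => hg0 (by rw [hgC, h, C_0]), ?_⟩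
  rw [← hgC, mul_comm]
  exact hg

open Polynomial in
/-- The negated derivative of the logarithmic derivative of a product of linear factors, with
denominators cleared. -/
theorem Polynomial.sum_inv_sq_mul_eval_prod_sq {K ι : Type*} [Field K] (s : Finset ι) (z : ι → K)
    (a : K) (ha : ∀ l ∈ s, a ≠ z l) :
    (∑ l ∈ s, ((a - z l) ^ 2)⁻¹) * (∏ l ∈ s, (X - C (z l))).eval a ^ 2
      = (derivative (∏ l ∈ s, (X - C (z l)))).eval a ^ 2
        - (derivative (derivative (∏ l ∈ s, (X - C (z l))))).eval a
          * (∏ l ∈ s, (X - C (z l))).eval a := by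
  classical
  induction s using Finset.induction_on with
  | empty => simp
  | insert b s hb ih =>
    have ih := ih fun l hl => ha l (Finset.mem_insert_of_mem hl)
    have hne : a - z b ≠ 0 := sub_ne_zero.mpr (ha b (Finset.mem_insert_self b s))
    rw [Finset.sum_insert hb, Finset.prod_insert hb]
    generalize ∏ l ∈ s, (X - C (z l)) = r at *
    simp only [derivative_mul, derivative_sub, derivative_X, derivative_C, derivative_add,
      eval_add, eval_mul, eval_sub, eval_X, eval_C, sub_zero, one_mul]
    have hi : ((a - z b) ^ 2)⁻¹ * (a - z b) ^ 2 = 1 := inv_mul_cancel₀ (pow_ne_zero 2 hne)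
    linear_combination (a - z b) ^ 2 * ih + r.eval a ^ 2 * hi

open Polynomial in
theorem sum_inv_sq_sub_hermiteP_roots {N : ℕ} {z : Fin N → ℝ} (hz : Function.Injective z)
    (hroot : ∀ i, (hermiteP N).eval (z i) = 0) (i : Fin N) :
    ∑ l ∈ Finset.univ.erase i, ((z i - z l) ^ 2)⁻¹ = (2 * ((N : ℝ) - 1) - z i ^ 2) / 3 := by
  obtain ⟨c, hc, hH⟩ :=
    eq_C_mul_prod_X_sub_C (hermiteP_ne_zero N) (natDegree_hermiteP_le N) hz hroot
  have hne : ∀ l ∈ Finset.univ.erase i, z i ≠ z l := fun l hl h =>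
    (Finset.ne_of_mem_erase hl) (hz h).symm
  have hsum := sum_inv_sq_mul_eval_prod_sq (Finset.univ.erase i) z (z i) hne
  have hq : (∏ l ∈ Finset.univ.erase i, (X - C (z l))).eval (z i) ≠ 0 := by
    rw [eval_prod, Finset.prod_ne_zero_iff]
    intro l hl
    simpa [sub_eq_zero] using hne l hl
  rw [← Finset.mul_prod_erase _ _ (Finset.mem_univ i)] at hH
  generalize ∏ l ∈ Finset.univ.erase i, (X - C (z l)) = q at *
  have ode := derivative_derivative_hermiteP N
  have ode' := congrArg derivative ode
  rw [hH] at ode ode'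
  have h1 := congrArg (eval (z i)) ode
  have h2 := congrArg (eval (z i)) ode'
  simp only [derivative_mul, derivative_sub, derivative_X, derivative_C, derivative_add,
    derivative_ofNat, eval_add, eval_mul, eval_sub, eval_X,
    eval_C, eval_ofNat, sub_self, sub_zero, zero_mul, mul_zero, zero_add,
    add_zero, one_mul, mul_one] at h1 h2
  have h1' : (derivative q).eval (z i) = z i * q.eval (z i) := by
    apply mul_left_cancel₀ hc
    linear_combination h1 / 2
  have h2' : 3 * (derivative (derivative q)).eval (z i)
      = (4 * z i ^ 2 - 2 * ((N : ℝ) - 1)) * q.eval (z i) := by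
    apply mul_left_cancel₀ hc
    linear_combination h2 + 4 * c * z i * h1'
  apply mul_right_cancel₀ (pow_ne_zero 2 hq)
  rw [hsum, h1']
  linear_combination -(q.eval (z i)) / 3 * h2'

/-- For the ordered roots `z 0 > z 1 > … > z (N-1)` of the Hermite
polynomial `H_N` (`N ≥ 2`), for every `i`,
`∑_{l ≠ i} 1/(z i - z l)² ≤ (N-1)^{3/2}/N^{1/2} ≤ N-1`. -/
theorem hermite_roots_square_sum_le
    (N : ℕ) (hN : 2 ≤ N) (z : Fin N → ℝ) (hz : StrictAnti z)
    (hroot : ∀ i, (hermiteP N).eval (z i) = 0) (i : Fin N) :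
    (∑ l ∈ Finset.univ.erase i, ((z i - z l) ^ 2)⁻¹
        ≤ ((N : ℝ) - 1) ^ ((3 : ℝ) / 2) / (N : ℝ) ^ ((1 : ℝ) / 2))
      ∧ ((N : ℝ) - 1) ^ ((3 : ℝ) / 2) / (N : ℝ) ^ ((1 : ℝ) / 2) ≤ (N : ℝ) - 1 := by
  have hN' : (2 : ℝ) ≤ N := by exact_mod_cast hN
  have hm : (0 : ℝ) ≤ (N : ℝ) - 1 := by linarith
  have hpos : (0 : ℝ) < N := by linarith
  have key : ((N : ℝ) - 1) ^ ((3 : ℝ) / 2) / (N : ℝ) ^ ((1 : ℝ) / 2)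
      = ((N : ℝ) - 1) * √(((N : ℝ) - 1) / N) := by
    rw [Real.sqrt_div hm, Real.sqrt_eq_rpow, Real.sqrt_eq_rpow,
      show (3 : ℝ) / 2 = 1 + 1 / 2 by norm_num, Real.rpow_add (by linarith), Real.rpow_one,
      mul_div_assoc]
  rw [key, sum_inv_sq_sub_hermiteP_roots hz.injective hroot i]
  constructor
  · have hs : (2 : ℝ) / 3 ≤ √(((N : ℝ) - 1) / N) := by
      apply Real.le_sqrt_of_sq_le
      rw [le_div_iff₀ hpos]
      linarith
    nlinarith [sq_nonneg (z i), mul_le_mul_of_nonneg_left hs hm]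
  · apply mul_le_of_le_one_right hm
    rw [Real.sqrt_le_one, div_le_one hpos]
    linarith
end

section
/- Let ν > 0, N ≥ 1, and let z_{1,N} > ... > z_{N,N} > 0 be the ordered roots of the Laguerre polynomial L_N^{(ν−1)}. Then for every i ∈ {1,...,N}, ( ν/z_{i,N} + 2 Σ_{l ≠ i} (z_{i,N} + z_{l,N})/(z_{i,N} − z_{l,N})² )² + 16 Σ_{l ≠ i} z_{i,N} z_{l,N}/(z_{i,N} − z_{l,N})⁴ ≤ (2N−1)². -/
/-- The generalized Laguerre polynomials `L_n^{(a)}`, orthogonal w.r.t. the weight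
`exp(-x)·x^a` on `(0,∞)` (for `a > -1`), defined via the standard three-term recurrence
`L_0^{(a)} = 1`, `L_1^{(a)} = 1 + a - X`,
`(n+2)·L_{n+2}^{(a)} = (2(n+1)+1+a-X)·L_{n+1}^{(a)} - (n+1+a)·L_n^{(a)}`. -/
noncomputable def laguerreP (a : ℝ) : ℕ → Polynomial ℝ
  | 0 => 1
  | 1 => Polynomial.C (1 + a) - Polynomial.X
  | n + 2 =>
      Polynomial.C (1 / ((n : ℝ) + 2)) *
        ((Polynomial.C (2 * ((n : ℝ) + 1) + 1 + a) - Polynomial.X) * laguerreP a (n + 1)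
          - Polynomial.C (((n : ℝ) + 1) + a) * laguerreP a n)

open Polynomial in
/-- Degree bound and non-vanishing top coefficient of the Laguerre polynomials. -/
theorem laguerreP_natDegree_le_and_coeff_ne_zero (a : ℝ) (n : ℕ) :
    (laguerreP a n).natDegree ≤ n ∧ (laguerreP a n).coeff n ≠ 0 := by
  induction n using Nat.strong_induction_on with
  | _ n ih =>
    match n, ih with
    | 0, _ => simp [laguerreP]
    | 1, _ =>
      constructor
      · rw [laguerreP]; compute_degree
      · simp [laguerreP, coeff_X, -map_add]
    | n + 2, ih =>
      obtain ⟨h1, h1'⟩ := ih (n + 1) (by lia)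
      obtain ⟨h0, -⟩ := ih n (by lia)
      constructor
      · rw [laguerreP]
        have hlin : (C (2 * ((n : ℝ) + 1) + 1 + a) - X).natDegree ≤ 1 := by compute_degree
        have hA := natDegree_mul_le_of_le hlin h1
        have hB := (natDegree_C_mul_le ((n : ℝ) + 1 + a) (laguerreP a n)).trans h0
        refine (natDegree_C_mul_le _ _).trans ((natDegree_sub_le _ _).trans (max_le ?_ ?_)) <;> lia
      · have e1 : (laguerreP a (n + 1)).coeff (n + 2) = 0 :=
          coeff_eq_zero_of_natDegree_lt (by lia)
        have e0 : (laguerreP a n).coeff (n + 2) = 0 :=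
          coeff_eq_zero_of_natDegree_lt (by lia)
        have : (n : ℝ) + 2 ≠ 0 := by positivity
        rw [laguerreP, coeff_C_mul, sub_mul, coeff_sub, coeff_sub, coeff_C_mul, coeff_C_mul,
          coeff_X_mul, e1, e0]
        simp [this, h1']

open Polynomial in
theorem laguerreP_recurrence (a : ℝ) (n : ℕ) :
    ((n : ℝ[X]) + 2) * laguerreP a (n + 2) =
      (2 * ((n : ℝ[X]) + 1) + 1 + C a - X) * laguerreP a (n + 1)
        - ((n : ℝ[X]) + 1 + C a) * laguerreP a n := by
  have h : (C ((n : ℝ) + 2)) * C (1 / ((n : ℝ) + 2)) = (1 : ℝ[X]) := by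
    rw [← C_mul, mul_one_div_cancel (by positivity), C_1]
  have hc : (C ((n : ℝ) + 2)) = (n : ℝ[X]) + 2 := by simp [← C_ofNat]
  have h2 : (C (2 : ℝ)) = (2 : ℝ[X]) := C_ofNat 2
  rw [← hc, laguerreP, ← mul_assoc, h]
  simp [h2]

open Polynomial in
theorem laguerreP_derivative_relations (a : ℝ) (n : ℕ) :
    X * derivative (laguerreP a (n + 1)) =
        ((n : ℝ[X]) + 1) * laguerreP a (n + 1) - ((n : ℝ[X]) + 1 + C a) * laguerreP a n ∧
      derivative (laguerreP a (n + 1)) = derivative (laguerreP a n) - laguerreP a n := by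
  induction n with
  | zero => constructor <;> simp [laguerreP]
  | succ n ih =>
    obtain ⟨hA, hB⟩ := ih
    have hr := laguerreP_recurrence a n
    have hd := congrArg derivative hr
    simp only [derivative_mul, derivative_add, derivative_sub, derivative_natCast,
      derivative_one, derivative_C, derivative_X, derivative_ofNat] at hd
    have hn : (n : ℝ[X]) + 2 ≠ 0 := by
      exact_mod_cast (Nat.cast_ne_zero (R := ℝ[X])).2 (show n + 2 ≠ 0 by lia)
    have hB' : derivative (laguerreP a (n + 2)) =
        derivative (laguerreP a (n + 1)) - laguerreP a (n + 1) := by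
      apply mul_left_cancel₀ hn
      linear_combination hd - hA + ((n : ℝ[X]) + 1 + C a) * hB
    refine ⟨?_, hB'⟩
    push_cast
    linear_combination X * hB' + hA - hr

open Polynomial in
/-- The Laguerre differential equation. -/
theorem laguerreP_differential_equation (a : ℝ) (n : ℕ) :
    X * derivative (derivative (laguerreP a n)) + (C (a + 1) - X) * derivative (laguerreP a n)
      + (n : ℝ[X]) * laguerreP a n = 0 := by
  cases n with
  | zero => simp [laguerreP]
  | succ n =>
    obtain ⟨hA, hB⟩ := laguerreP_derivative_relations a n
    have hd := congrArg derivative hA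
    simp only [derivative_mul, derivative_add, derivative_sub, derivative_natCast,
      derivative_one, derivative_C, derivative_X] at hd
    simp only [C_add, C_1]
    push_cast
    linear_combination hd + ((n : ℝ[X]) + 1 + C a) * hB - hA

/-- The nodal polynomial of the roots satisfies the Laguerre differential equation. -/
theorem laguerreP_nodal_differential_equation {ν : ℝ} {N : ℕ} {z : Fin N → ℝ}
    (hz : Function.Injective z) (hroot : ∀ i, (laguerreP (ν - 1) N).eval (z i) = 0) :
    let P := ∏ l, (Polynomial.X - Polynomial.C (z l))
    Polynomial.X * P.derivative.derivative + (Polynomial.C ν - Polynomial.X) * P.derivative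
      + (N : Polynomial ℝ) * P = 0 := by
  intro P
  obtain ⟨hdeg, hcoeff⟩ := laguerreP_natDegree_le_and_coeff_ne_zero (ν - 1) N
  have hPm : P.Monic := Polynomial.monic_prod_of_monic _ _ fun l _ => Polynomial.monic_X_sub_C _
  have hPdeg : P.natDegree = N := by
    simp [P, Polynomial.natDegree_finsetProd_X_sub_C_eq_card]
  have hL : laguerreP (ν - 1) N = Polynomial.C ((laguerreP (ν - 1) N).coeff N) * P := by
    refine Polynomial.eq_of_degree_sub_lt_of_eval_index_eq Finset.univ hz.injOn ?_ ?_
    · rw [Finset.card_univ, Fintype.card_fin, Polynomial.degree_lt_iff_coeff_zero]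
      intro m hm
      rcases hm.eq_or_lt with rfl | hm
      · have : P.coeff N = 1 := by rw [← hPm.coeff_natDegree, hPdeg]
        simp [this]
      · rw [Polynomial.coeff_sub, Polynomial.coeff_C_mul,
          Polynomial.coeff_eq_zero_of_natDegree_lt (hdeg.trans_lt hm),
          Polynomial.coeff_eq_zero_of_natDegree_lt (hPdeg.trans_lt hm)]
        simp
    · intro i _
      have : P.eval (z i) = 0 := by
        rw [Polynomial.eval_prod]
        exact Finset.prod_eq_zero (Finset.mem_univ i) (by simp)
      rw [hroot i, Polynomial.eval_mul, this, mul_zero]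
  have hode := laguerreP_differential_equation (ν - 1) N
  rw [hL] at hode
  simp only [Polynomial.derivative_C_mul, sub_add_cancel] at hode
  refine (mul_eq_zero.1 (?_ : Polynomial.C ((laguerreP (ν - 1) N).coeff N) * _ = 0)).resolve_left
    (Polynomial.C_ne_zero.2 hcoeff)
  linear_combination hode

/-- First and second derivative of a product of linear factors, away from its roots. -/
theorem eval_derivative_prod_X_sub_C {ι : Type*} (s : Finset ι) (z : ι → ℝ) (x : ℝ)
    (hx : ∀ l ∈ s, x - z l ≠ 0) :
    let Q := ∏ l ∈ s, (Polynomial.X - Polynomial.C (z l))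
    Q.derivative.eval x = Q.eval x * ∑ l ∈ s, 1 / (x - z l) ∧
    Q.derivative.derivative.eval x =
      Q.eval x * ((∑ l ∈ s, 1 / (x - z l)) ^ 2 - ∑ l ∈ s, 1 / (x - z l) ^ 2) := by
  classical
  induction s using Finset.induction_on with
  | empty => simp
  | insert j s hj ih =>
    obtain ⟨h1, h2⟩ := ih fun l hl => hx l (Finset.mem_insert_of_mem hl)
    have hxj := hx j (Finset.mem_insert_self j s)
    simp only [Finset.prod_insert hj, Finset.sum_insert hj, Polynomial.derivative_mul,
      Polynomial.derivative_add, Polynomial.derivative_sub, Polynomial.derivative_X,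
      Polynomial.derivative_C, Polynomial.eval_add, Polynomial.eval_mul, Polynomial.eval_sub,
      Polynomial.eval_X, Polynomial.eval_C, Polynomial.eval_one, Polynomial.eval_zero,
      Polynomial.derivative_one, Polynomial.derivative_zero] at h1 h2 ⊢
    rw [h1, h2]
    constructor
    · field_simp
      ring
    · field_simp
      ring

section LagrangeBasis

open Polynomial

variable {N : ℕ} {ν : ℝ} {z : Fin N → ℝ}

/-- The product of `X - z l` over all `l ≠ j`. -/
noncomputable def nodalErase (z : Fin N → ℝ) (j : Fin N) : ℝ[X] :=
  ∏ l ∈ Finset.univ.erase j, (X - C (z l))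

/-- The operator `q ↦ x q'' + (ν - x) q' + N q`. -/
noncomputable def laguerreOp (ν : ℝ) (N : ℕ) : ℝ[X] →ₗ[ℝ] ℝ[X] :=
  LinearMap.mulLeft ℝ X ∘ₗ derivative ∘ₗ derivative
    + LinearMap.mulLeft ℝ (C ν - X) ∘ₗ derivative + LinearMap.mulLeft ℝ (N : ℝ[X])

theorem laguerreOp_apply (ν : ℝ) (N : ℕ) (q : ℝ[X]) :
    laguerreOp ν N q =
      X * derivative (derivative q) + (C ν - X) * derivative q + (N : ℝ[X]) * q := rfl

theorem eval_nodalErase_of_ne {i j : Fin N} (h : i ≠ j) : (nodalErase z j).eval (z i) = 0 := by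
  rw [nodalErase, eval_prod]
  exact Finset.prod_eq_zero (Finset.mem_erase.2 ⟨h, Finset.mem_univ i⟩) (by simp)

theorem eval_nodalErase_self_ne_zero (hz : Function.Injective z) (j : Fin N) :
    (nodalErase z j).eval (z j) ≠ 0 := by
  rw [nodalErase, eval_prod]
  refine Finset.prod_ne_zero_iff.2 fun l hl => ?_
  simpa [sub_eq_zero] using fun h => Finset.ne_of_mem_erase hl (hz h).symm

theorem prod_X_sub_C_eq_mul_nodalErase (z : Fin N → ℝ) (j : Fin N) :
    ∏ l, (X - C (z l)) = (X - C (z j)) * nodalErase z j :=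
  (Finset.mul_prod_erase _ _ (Finset.mem_univ j)).symm

theorem X_sub_C_mul_laguerreOp_nodalErase (h : laguerreOp ν N (∏ l, (X - C (z l))) = 0)
    (j : Fin N) :
    (X - C (z j)) * laguerreOp ν N (nodalErase z j) =
      -(2 * X * derivative (nodalErase z j) + (C ν - X) * nodalErase z j) := by
  rw [prod_X_sub_C_eq_mul_nodalErase z j, laguerreOp_apply] at h
  simp only [derivative_mul, derivative_add, derivative_sub, derivative_X,
    derivative_C, sub_zero, one_mul] at h
  rw [laguerreOp_apply]
  linear_combination h

theorem eval_laguerreOp_nodalErase_of_ne (hz : Function.Injective z)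
    (h : laguerreOp ν N (∏ l, (X - C (z l))) = 0) {i j : Fin N} (hij : i ≠ j) :
    (laguerreOp ν N (nodalErase z j)).eval (z i) =
      -((nodalErase z i).eval (z i) * (2 * z i / (z i - z j) ^ 2)) := by
  have hne : z i - z j ≠ 0 := sub_ne_zero.2 fun e => hij (hz e)
  have h1 := congrArg (eval (z i)) (X_sub_C_mul_laguerreOp_nodalErase h j)
  have h2 := congrArg (fun q => (derivative q).eval (z i))
    ((prod_X_sub_C_eq_mul_nodalErase z i).symm.trans (prod_X_sub_C_eq_mul_nodalErase z j))
  simp only [derivative_mul, derivative_sub, derivative_X, derivative_C, eval_add, eval_mul,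
    eval_sub, eval_X, eval_C, eval_neg, eval_one, eval_zero, eval_ofNat,
    eval_nodalErase_of_ne hij, sub_self] at h1 h2
  field_simp
  linear_combination (z i - z j) * h1 + 2 * z i * h2

theorem eval_laguerreOp_nodalErase_self (hz : Function.Injective z)
    (h : laguerreOp ν N (∏ l, (X - C (z l))) = 0) {i : Fin N} (hi : z i ≠ 0) :
    (laguerreOp ν N (nodalErase z i)).eval (z i) =
      (nodalErase z i).eval (z i) *
        ((1 + (ν / z i + 2 * ∑ l ∈ Finset.univ.erase i, (z i + z l) / (z i - z l) ^ 2)) / 2) := by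
  have hne : ∀ l ∈ Finset.univ.erase i, z i - z l ≠ 0 := fun l hl =>
    sub_ne_zero.2 fun e => Finset.ne_of_mem_erase hl (hz e).symm
  obtain ⟨d1, d2⟩ := eval_derivative_prod_X_sub_C (Finset.univ.erase i) z (z i) hne
  have hX := X_sub_C_mul_laguerreOp_nodalErase h i
  have h1 := congrArg (eval (z i)) hX
  have h2 := congrArg (fun q => (derivative q).eval (z i)) hX
  have hsum : ∑ l ∈ Finset.univ.erase i, (z i + z l) / (z i - z l) ^ 2 =
      2 * z i * ∑ l ∈ Finset.univ.erase i, 1 / (z i - z l) ^ 2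
        - ∑ l ∈ Finset.univ.erase i, 1 / (z i - z l) := by
    rw [Finset.mul_sum, ← Finset.sum_sub_distrib]
    refine Finset.sum_congr rfl fun l hl => ?_
    have := hne l hl
    field_simp
    ring
  have hP := eval_nodalErase_self_ne_zero hz i
  change (derivative (nodalErase z i)).eval (z i) = (nodalErase z i).eval (z i) * _ at d1
  change (derivative (derivative (nodalErase z i))).eval (z i) =
    (nodalErase z i).eval (z i) * _ at d2
  rw [hsum]
  set S := ∑ l ∈ Finset.univ.erase i, 1 / (z i - z l)
  set R := ∑ l ∈ Finset.univ.erase i, 1 / (z i - z l) ^ 2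
  simp only [derivative_mul, derivative_add, derivative_sub, derivative_neg, derivative_X,
    derivative_C, derivative_ofNat, eval_add, eval_mul, eval_sub, eval_X, eval_C, eval_neg,
    eval_one, eval_zero, eval_ofNat, sub_self, d1, d2] at h1 h2
  have hS : 2 * z i * S + (ν - z i) = 0 := by
    apply mul_left_cancel₀ hP
    linear_combination h1
  have hν : ν / z i = 1 - 2 * S := by
    field_simp
    linear_combination hS
  rw [hν]
  linear_combination h2 - (nodalErase z i).eval (z i) * S * hS

theorem degree_nodalErase_lt (z : Fin N → ℝ) (j : Fin N) :
    (nodalErase z j).degree < N := by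
  have hN : 0 < N := j.pos
  refine (degree_le_natDegree).trans_lt ?_
  rw [nodalErase, natDegree_finsetProd_X_sub_C_eq_card]
  rw [Finset.card_erase_of_mem (Finset.mem_univ j), Finset.card_univ, Fintype.card_fin]
  exact_mod_cast Nat.sub_lt hN one_pos

/-- An eigenvalue of `laguerreOp ν N` on polynomials of degree `< N` is at least `1` and at most `N`. -/
theorem laguerreOp_eigenvalue {q : ℝ[X]} (hq : q ≠ 0) (hdeg : q.degree < N) {μ : ℝ}
    (h : laguerreOp ν N q = C μ * q) : 1 ≤ μ ∧ μ ≤ N := by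
  have hk : q.natDegree < N := (natDegree_lt_iff_degree_lt hq).2 hdeg
  have hl : q.coeff q.natDegree ≠ 0 := by simpa using hq
  have e2 : (derivative q).coeff q.natDegree = 0 := by
    rw [coeff_derivative, coeff_eq_zero_of_natDegree_lt (Nat.lt_succ_self _), zero_mul]
  have hX1 : (X * derivative q).coeff q.natDegree = q.natDegree * q.coeff q.natDegree := by
    rcases hn : q.natDegree with _ | k
    · simp
    · rw [coeff_X_mul, coeff_derivative]; push_cast; ring
  have hX2 : (X * derivative (derivative q)).coeff q.natDegree = 0 := by
    rcases hn : q.natDegree with _ | k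
    · simp
    · rw [hn] at e2
      rw [coeff_X_mul, coeff_derivative, e2, zero_mul]
  have hc := congrArg (fun p => p.coeff q.natDegree) h
  simp only [laguerreOp_apply, sub_mul, coeff_add, coeff_sub, coeff_C_mul, hX1, hX2, e2,
    coeff_natCast_mul] at hc
  have hμ : μ = N - q.natDegree := by
    apply mul_right_cancel₀ hl
    linear_combination -hc
  have hk' : (q.natDegree : ℝ) + 1 ≤ N := by exact_mod_cast hk
  have : (0 : ℝ) ≤ q.natDegree := by positivity
  constructor <;> linarith

end LagrangeBasis

/-- The symmetric matrix whose rows have the squared norms in the inequality. -/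
noncomputable def laguerreMatrix (ν : ℝ) {N : ℕ} (z : Fin N → ℝ) : Matrix (Fin N) (Fin N) ℝ :=
  fun i j =>
    if i = j then ν / z i + 2 * ∑ l ∈ Finset.univ.erase i, (z i + z l) / (z i - z l) ^ 2
    else -(4 * (√(z i) * √(z j)) / (z i - z j) ^ 2)

theorem laguerreMatrix_isHermitian (ν : ℝ) {N : ℕ} (z : Fin N → ℝ) :
    (laguerreMatrix ν z).IsHermitian := by
  ext i j
  rw [Matrix.conjTranspose_apply, star_trivial]
  rcases eq_or_ne i j with rfl | hij
  · rfl
  · rw [laguerreMatrix, laguerreMatrix, if_neg hij, if_neg hij.symm, mul_comm √(z i),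
      ← neg_sub (z i), neg_sq]

open Polynomial in
theorem laguerreMatrix_eigenvalue_bounds {ν : ℝ} {N : ℕ} {z : Fin N → ℝ}
    (hz : Function.Injective z) (hpos : ∀ i, 0 < z i)
    (hroot : ∀ i, (laguerreP (ν - 1) N).eval (z i) = 0) {v : Fin N → ℝ} (hv : v ≠ 0) {μ : ℝ}
    (h : (laguerreMatrix ν z).mulVec v = μ • v) : 1 ≤ μ ∧ μ ≤ 2 * N - 1 := by
  have hode : laguerreOp ν N (∏ l, (X - C (z l))) = 0 :=
    laguerreP_nodal_differential_equation hz hroot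
  set q : ℝ[X] := ∑ j, (√(z j) * v j) • nodalErase z j with hqdef
  have hqeval (i : Fin N) : q.eval (z i) = √(z i) * v i * (nodalErase z i).eval (z i) := by
    rw [hqdef, eval_finsetSum, Finset.sum_eq_single i]
    · simp
    · intro j _ hj
      simp [eval_nodalErase_of_ne hj.symm]
    · simp
  have hqdeg : q.degree < N :=
    (degree_lt_iff_coeff_zero _ _).2 fun m hm => by
      rw [hqdef, finsetSum_coeff]
      refine Finset.sum_eq_zero fun j _ => ?_
      rw [coeff_smul, (degree_lt_iff_coeff_zero _ _).1 (degree_nodalErase_lt z j) m hm, smul_zero]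
  have hq : q ≠ 0 := by
    intro h0
    apply hv
    funext i
    have := hqeval i
    rw [h0, eval_zero] at this
    have hs := (Real.sqrt_pos.2 (hpos i)).ne'
    have hP := eval_nodalErase_self_ne_zero hz i
    simpa [hs, hP] using this.symm
  have hTeval (i : Fin N) :
      (laguerreOp ν N q).eval (z i) = (μ + 1) / 2 * q.eval (z i) := by
    have hi := congrFun h i
    rw [Matrix.mulVec, dotProduct, ← Finset.add_sum_erase _ _ (Finset.mem_univ i)] at hi
    simp only [laguerreMatrix, if_true, Pi.smul_apply, smul_eq_mul] at hi
    have hoff : ∑ j ∈ Finset.univ.erase i, (√(z j) * v j) *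
          (laguerreOp ν N (nodalErase z j)).eval (z i) =
        (nodalErase z i).eval (z i) * √(z i) / 2 * ∑ j ∈ Finset.univ.erase i,
          (if i = j then ν / z i + 2 * ∑ l ∈ Finset.univ.erase i, (z i + z l) / (z i - z l) ^ 2
            else -(4 * (√(z i) * √(z j)) / (z i - z j) ^ 2)) * v j := by
      rw [Finset.mul_sum]
      refine Finset.sum_congr rfl fun j hj => ?_
      have hij := (Finset.ne_of_mem_erase hj).symm
      rw [if_neg hij, eval_laguerreOp_nodalErase_of_ne hz hode hij]
      have hne : z i - z j ≠ 0 := sub_ne_zero.2 fun e => hij (hz e)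
      field_simp
      rw [Real.sq_sqrt (hpos i).le]
      ring
    rw [hqeval, hqdef, map_sum, eval_finsetSum, ← Finset.add_sum_erase _ _ (Finset.mem_univ i)]
    simp only [map_smul, eval_smul, smul_eq_mul]
    rw [hoff, eval_laguerreOp_nodalErase_self hz hode (hpos i).ne']
    linear_combination (nodalErase z i).eval (z i) * √(z i) / 2 * hi
  have hT : laguerreOp ν N q = C ((μ + 1) / 2) * q := by
    refine eq_of_degree_sub_lt_of_eval_index_eq Finset.univ hz.injOn ?_ fun i _ => by
      rw [hTeval, eval_C_mul]
    rw [Finset.card_univ, Fintype.card_fin, degree_lt_iff_coeff_zero]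
    rw [degree_lt_iff_coeff_zero] at hqdeg
    intro m hm
    have e1 : (derivative q).coeff m = 0 := by
      rw [coeff_derivative, hqdeg _ (by lia), zero_mul]
    rcases m with _ | m
    · simp [laguerreOp_apply, sub_mul, e1, hqdeg _ hm]
    · simp [laguerreOp_apply, sub_mul, coeff_derivative, coeff_natCast_mul, hqdeg _ hm,
        hqdeg (m + 1 + 1) (by lia)]
  obtain ⟨h1, h2⟩ := laguerreOp_eigenvalue hq hqdeg hT
  constructor <;> linarith

/-- Row norms of a symmetric real matrix are bounded by any bound on its eigenvalues. -/
theorem Matrix.IsHermitian.sum_sq_row_le {n : Type*} [Fintype n] [DecidableEq n]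
    {A : Matrix n n ℝ} (hA : A.IsHermitian) {c : ℝ} (hc : ∀ k, hA.eigenvalues k ^ 2 ≤ c) (i : n) :
    ∑ j, A i j ^ 2 ≤ c := by
  set b := hA.eigenvectorBasis
  have hrow : ∑ j, A i j ^ 2 = ‖WithLp.toLp 2 (A i)‖ ^ 2 := by
    simp [EuclideanSpace.norm_sq_eq]
  have hcoef (k : n) : inner ℝ (b k) (WithLp.toLp 2 (A i)) = hA.eigenvalues k * b k i := by
    have := congrFun (hA.mulVec_eigenvectorBasis k) i
    simpa [Matrix.mulVec, PiLp.inner_apply, dotProduct, mul_comm] using this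
  have hone : ∑ k, (b k i) ^ 2 = 1 := by
    have := b.sum_sq_norm_inner_right (EuclideanSpace.single i (1 : ℝ))
    simpa [EuclideanSpace.inner_single_right] using this
  calc ∑ j, A i j ^ 2 = ∑ k, (hA.eigenvalues k * b k i) ^ 2 := by
        rw [hrow, ← b.sum_sq_norm_inner_right]
        simp only [hcoef, Real.norm_eq_abs, sq_abs]
    _ ≤ ∑ k, c * (b k i) ^ 2 := by
        refine Finset.sum_le_sum fun k _ => ?_
        rw [mul_pow]
        exact mul_le_mul_of_nonneg_right (hc k) (sq_nonneg _)
    _ = c := by rw [← Finset.mul_sum, hone, mul_one]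

/-- For the ordered roots `z 0 > … > z (N-1) > 0` of the Laguerre
polynomial `L_N^{(ν-1)}` (`ν > 0`, `N ≥ 1`), for every `i`,
`(ν/z i + 2·∑_{l ≠ i} (z i + z l)/(z i - z l)²)²
  + 16·∑_{l ≠ i} (z i · z l)/(z i - z l)⁴ ≤ (2N-1)²`. -/
theorem laguerre_roots_inequality
    (ν : ℝ) (hν : 0 < ν) (N : ℕ) (hN : 1 ≤ N) (z : Fin N → ℝ)
    (hz : StrictAnti z) (hpos : ∀ i, 0 < z i)
    (hroot : ∀ i, (laguerreP (ν - 1) N).eval (z i) = 0) (i : Fin N) :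
    (ν / z i + 2 * ∑ l ∈ Finset.univ.erase i, (z i + z l) / (z i - z l) ^ 2) ^ 2
        + 16 * ∑ l ∈ Finset.univ.erase i, (z i * z l) / (z i - z l) ^ 4
      ≤ (2 * (N : ℝ) - 1) ^ 2 := by
  have hsym := laguerreMatrix_isHermitian ν z
  have hbound (k : Fin N) : hsym.eigenvalues k ^ 2 ≤ (2 * (N : ℝ) - 1) ^ 2 := by
    have hne : (hsym.eigenvectorBasis k).ofLp ≠ 0 := fun h0 =>
      hsym.eigenvectorBasis.orthonormal.ne_zero k (by ext j; exact congrFun h0 j)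
    obtain ⟨h1, h2⟩ := laguerreMatrix_eigenvalue_bounds hz.injective hpos hroot hne
      (hsym.mulVec_eigenvectorBasis k)
    exact pow_le_pow_left₀ (by linarith) h2 2
  refine le_trans (le_of_eq ?_) (hsym.sum_sq_row_le hbound i)
  rw [← Finset.add_sum_erase _ _ (Finset.mem_univ i)]
  congr 1
  · simp [laguerreMatrix]
  · rw [Finset.mul_sum]
    refine Finset.sum_congr rfl fun j hj => ?_
    rw [laguerreMatrix, if_neg (Finset.ne_of_mem_erase hj).symm, neg_sq, div_pow, mul_pow, mul_pow,
      Real.sq_sqrt (hpos i).le, Real.sq_sqrt (hpos j).le]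
    ring
end

section
/- Let ν > 0, N ≥ 1, and let z_{1,N} > ... > z_{N,N} > 0 be the ordered roots of the Laguerre polynomial L_N^{(ν−1)}. Then the smallest root satisfies z_{N,N} ≥ ν/(2N−1). -/
theorem laguerreP_eval_add_two (ν x : ℝ) (n : ℕ) :
    ((n : ℝ) + 2) * (laguerreP (ν - 1) (n + 2)).eval x =
      (2 * n + 2 + ν - x) * (laguerreP (ν - 1) (n + 1)).eval x
        - (n + ν) * (laguerreP (ν - 1) n).eval x := by
  have h : (n : ℝ) + 2 ≠ 0 := by positivity
  simp only [laguerreP, Polynomial.eval_mul, Polynomial.eval_sub, Polynomial.eval_C,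
    Polynomial.eval_X]
  field_simp
  ring

theorem laguerreP_eval_zero_succ (ν : ℝ) (n : ℕ) :
    ((n : ℝ) + 1) * (laguerreP (ν - 1) (n + 1)).eval 0 =
      (n + ν) * (laguerreP (ν - 1) n).eval 0 := by
  induction n with
  | zero => simp [laguerreP]
  | succ n ih =>
    have h := laguerreP_eval_add_two ν 0 n
    push_cast
    linear_combination h + ih

theorem laguerreP_eval_zero_pos {ν : ℝ} (hν : 0 < ν) (n : ℕ) :
    0 < (laguerreP (ν - 1) n).eval 0 := by
  induction n with
  | zero => simp [laguerreP]
  | succ n ih =>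
    have h := laguerreP_eval_zero_succ ν n
    have h' : 0 < ((n : ℝ) + ν) * (laguerreP (ν - 1) n).eval 0 := by positivity
    rw [← h] at h'
    exact pos_of_mul_pos_right h' (by positivity)

/-- The Laguerre polynomial normalized to take the value `1` at `0`. -/
noncomputable def laguerreRatio (ν x : ℝ) (n : ℕ) : ℝ :=
  (laguerreP (ν - 1) n).eval x / (laguerreP (ν - 1) n).eval 0

theorem laguerreRatio_sub_succ {ν : ℝ} (hν : 0 < ν) (x : ℝ) (n : ℕ) :
    ((n : ℝ) + 1 + ν) * (laguerreRatio ν x (n + 1) - laguerreRatio ν x (n + 2)) =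
      (n + 1) * (laguerreRatio ν x n - laguerreRatio ν x (n + 1))
        + x * laguerreRatio ν x (n + 1) := by
  have eval_eq (k : ℕ) : (laguerreP (ν - 1) k).eval x =
      laguerreRatio ν x k * (laguerreP (ν - 1) k).eval 0 :=
    (div_mul_cancel₀ _ (laguerreP_eval_zero_pos hν k).ne').symm
  have h := laguerreP_eval_add_two ν x n
  rw [eval_eq n, eval_eq (n + 1), eval_eq (n + 2)] at h
  have h0 := laguerreP_eval_zero_succ ν n
  have h1 := laguerreP_eval_zero_succ ν (n + 1)
  push_cast at h1
  apply mul_right_cancel₀ (laguerreP_eval_zero_pos hν (n + 1)).ne'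
  linear_combination -h + laguerreRatio ν x (n + 2) * h1 - laguerreRatio ν x n * h0

theorem laguerreRatio_bounds {ν x : ℝ} (hν : 0 < ν) (hx : 0 ≤ x) (n : ℕ) (hn : n * x ≤ ν) :
    1 - n * (x / ν) ≤ laguerreRatio ν x n ∧ laguerreRatio ν x n ≤ 1 ∧
      0 ≤ laguerreRatio ν x n - laguerreRatio ν x (n + 1) ∧
      laguerreRatio ν x n - laguerreRatio ν x (n + 1) ≤ x / ν := by
  induction n with
  | zero =>
    have h : laguerreRatio ν x 0 - laguerreRatio ν x 1 = x / ν := by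
      simp [laguerreRatio, laguerreP]
      field_simp
      ring
    rw [zero_add, h]
    exact ⟨by simp [laguerreRatio, laguerreP], by simp [laguerreRatio, laguerreP],
      by positivity, le_rfl⟩
  | succ n ih =>
    push_cast at hn ⊢
    obtain ⟨h1, h2, h3, h4⟩ := ih (by linarith)
    have lower : 1 - ((n : ℝ) + 1) * (x / ν) ≤ laguerreRatio ν x (n + 1) := by linarith
    have upper : laguerreRatio ν x (n + 1) ≤ 1 := by linarith
    have hle : ((n : ℝ) + 1) * (x / ν) ≤ 1 := by
      rw [← mul_div_assoc]
      exact (div_le_one hν).2 hn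
    have nonneg : 0 ≤ laguerreRatio ν x (n + 1) := by linarith
    have hrec := laguerreRatio_sub_succ hν x n
    have hpos : 0 < (n : ℝ) + 1 + ν := by positivity
    refine ⟨lower, upper, ?_, ?_⟩
    · refine nonneg_of_mul_nonneg_right (a := (n : ℝ) + 1 + ν) ?_ hpos
      rw [hrec]
      positivity
    · refine le_of_mul_le_mul_left ?_ hpos
      rw [hrec]
      have e : ν * (x / ν) = x := mul_div_cancel₀ x hν.ne'
      have a1 := mul_le_mul_of_nonneg_left h4 (by positivity : (0 : ℝ) ≤ n + 1)
      have a2 := mul_le_mul_of_nonneg_left upper hx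
      linarith

theorem le_mul_of_laguerreP_eval_eq_zero {ν x : ℝ} (hν : 0 < ν) (hx : 0 ≤ x) (n : ℕ)
    (h : (laguerreP (ν - 1) n).eval x = 0) : ν ≤ n * x := by
  by_contra! hlt
  have h1 := (laguerreRatio_bounds hν hx n hlt.le).1
  rw [laguerreRatio, h, zero_div, ← mul_div_assoc] at h1
  have h2 := (div_lt_one hν).2 hlt
  linarith

/-- For the ordered roots `z 0 > … > z (N-1) > 0` of the Laguerre
polynomial `L_N^{(ν-1)}` (`ν > 0`, `N ≥ 1`), the smallest root satisfies
`z (N-1) ≥ ν/(2N-1)`. -/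
theorem laguerre_smallest_root_ge
    (ν : ℝ) (hν : 0 < ν) (N : ℕ) (hN : 1 ≤ N) (z : Fin N → ℝ)
    (hz : StrictAnti z) (hpos : ∀ i, 0 < z i)
    (hroot : ∀ i, (laguerreP (ν - 1) N).eval (z i) = 0) :
    z ⟨N - 1, Nat.sub_lt (by omega) one_pos⟩ ≥ ν / (2 * (N : ℝ) - 1) := by
  have hN' : (1 : ℝ) ≤ N := by exact_mod_cast hN
  have hx := hpos ⟨N - 1, Nat.sub_lt (by omega) one_pos⟩
  have h := le_mul_of_laguerreP_eval_eq_zero hν hx.le N (hroot _)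
  rw [ge_iff_le, div_le_iff₀ (by linarith)]
  nlinarith
end

section
/- Let ν > 0, N ≥ 1, and let z_{1,N} > ... > z_{N,N} > 0 be the ordered roots of the Laguerre polynomial L_N^{(ν−1)}. Then Σ_{i=1}^N [ ( ν/z_{i,N} + 2 Σ_{l ≠ i} (z_{i,N} + z_{l,N})/(z_{i,N} − z_{l,N})² )² + 16 Σ_{l ≠ i} z_{i,N} z_{l,N}/(z_{i,N} − z_{l,N})⁴ ] = N(2N−1)(2N+1)/3, where the inner sums over l run over l ∈ {1,...,N} with l ≠ i. -/
open Polynomial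

/-- The derivative relations between consecutive Laguerre polynomials. -/
lemma laguerreP_derivative (a : ℝ) (n : ℕ) :
    derivative (laguerreP a (n + 1)) = derivative (laguerreP a n) - laguerreP a n ∧
    X * derivative (laguerreP a (n + 1)) =
      C ((n : ℝ) + 1) * laguerreP a (n + 1) - C ((n : ℝ) + 1 + a) * laguerreP a n := by
  induction n with
  | zero =>
    constructor
    · simp [laguerreP]
    · simp [laguerreP]
  | succ n ih =>
    obtain ⟨hB, hA⟩ := ih
    have hn : (n : ℝ) + 2 ≠ 0 := by positivity
    have hrec : C ((n : ℝ) + 2) * laguerreP a (n + 2) =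
        (C (2 * ((n : ℝ) + 1) + 1 + a) - X) * laguerreP a (n + 1)
          - C (((n : ℝ) + 1) + a) * laguerreP a n := by
      rw [laguerreP, ← mul_assoc, ← C_mul, mul_one_div_cancel hn, C_1, one_mul]
    have hrec' := congrArg derivative hrec
    simp only [derivative_mul, derivative_sub, derivative_C, derivative_X, zero_mul, zero_add,
      zero_sub] at hrec'
    have hB' : derivative (laguerreP a (n + 2)) =
        derivative (laguerreP a (n + 1)) - laguerreP a (n + 1) := by
      apply mul_left_cancel₀ (C_ne_zero.mpr hn)
      simp only [C_add, C_mul, C_1, C_ofNat] at hrec hrec' hA ⊢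
      linear_combination hrec' - hA + (C (n : ℝ) + 1 + C a) * hB
    refine ⟨hB', ?_⟩
    rw [show n + 1 + 1 = n + 2 from rfl, hB']
    push_cast
    simp only [C_add, C_mul, C_1, C_ofNat] at hrec hA ⊢
    linear_combination hA - hrec

/-- Laguerre's differential equation. -/
lemma laguerreP_ode (a : ℝ) (n : ℕ) :
    X * derivative (derivative (laguerreP a n))
      + (C (1 + a) - X) * derivative (laguerreP a n) + C (n : ℝ) * laguerreP a n = 0 := by
  cases n with
  | zero => simp [laguerreP]
  | succ n =>
    obtain ⟨hB, hA⟩ := laguerreP_derivative a n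
    have hA' := congrArg derivative hA
    simp only [derivative_mul, derivative_sub, derivative_C, derivative_X, zero_mul, zero_add,
      one_mul] at hA'
    push_cast
    simp only [C_add, C_1] at hA hA' ⊢
    linear_combination hA' - hA + (C (n : ℝ) + 1 + C a) * hB

lemma laguerreP_natDegree_le (a : ℝ) (n : ℕ) : (laguerreP a n).natDegree ≤ n := by
  induction n using Nat.twoStepInduction with
  | zero => simp [laguerreP]
  | one => rw [laguerreP]; compute_degree
  | more n h₀ h₁ =>
    rw [laguerreP]
    refine (natDegree_C_mul_le _ _).trans ((natDegree_sub_le _ _).trans (max_le ?_ ?_))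
    · refine natDegree_mul_le.trans ?_
      have : (C (2 * ((n : ℝ) + 1) + 1 + a) - X).natDegree ≤ 1 := by compute_degree
      omega
    · exact (natDegree_C_mul_le _ _).trans (h₀.trans (by omega))

lemma laguerreP_eval_zero_pos_s11 {a : ℝ} (ha : -1 < a) (n : ℕ) : 0 < (laguerreP a n).eval 0 := by
  induction n with
  | zero => simp [laguerreP]
  | succ n ih =>
    have h := congrArg (eval 0) (laguerreP_derivative a n).2
    simp only [eval_mul, eval_X, eval_C, eval_sub, zero_mul] at h
    have hn : (0 : ℝ) ≤ n := n.cast_nonneg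
    have : 0 < ((n : ℝ) + 1) * (laguerreP a (n + 1)).eval 0 := by
      rw [sub_eq_zero.mp h.symm]
      exact mul_pos (by linarith) ih
    exact pos_of_mul_pos_right this (by linarith)

/-- A Laguerre polynomial with as many distinct real roots as its index is a scalar multiple of
the product of the corresponding linear factors. -/
lemma laguerreP_eq_C_mul_prod {a : ℝ} (ha : -1 < a) {n : ℕ} {z : Fin n → ℝ}
    (hz : Function.Injective z) (hroot : ∀ i, (laguerreP a n).eval (z i) = 0) :
    ∃ c : ℝ, c ≠ 0 ∧ laguerreP a n = C c * ∏ i, (X - C (z i)) := by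
  have h0 : laguerreP a n ≠ 0 := by
    intro h
    simpa [h] using laguerreP_eval_zero_pos_s11 ha n
  obtain ⟨r, hr⟩ : ∏ i, (X - C (z i)) ∣ laguerreP a n :=
    Finset.prod_dvd_of_coprime ((pairwise_coprime_X_sub_C hz).set_pairwise _)
      fun i _ => dvd_iff_isRoot.mpr (hroot i)
  have hmonic : (∏ i, (X - C (z i))).Monic := monic_prod_of_monic _ _ fun i _ => monic_X_sub_C _
  have hr0 : r ≠ 0 := by
    rintro rfl
    exact h0 (by simpa using hr)
  have hdeg := laguerreP_natDegree_le a n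
  rw [hr, hmonic.natDegree_mul' hr0, natDegree_finsetProd_X_sub_C_eq_card,
    Finset.card_univ, Fintype.card_fin] at hdeg
  obtain ⟨c, rfl⟩ := natDegree_eq_zero.mp (show r.natDegree = 0 by omega)
  exact ⟨c, by simpa using hr0, by rw [hr, mul_comm]⟩

/-- The first four derivatives of a product of linear factors, expressed through the power sums of
the reciprocals `1 / (x - z l)`. -/
lemma derivatives_prod_X_sub_C {ι : Type*} (s : Finset ι) (z : ι → ℝ) (x : ℝ)
    (hx : ∀ l ∈ s, x - z l ≠ 0) {q : ℝ[X]} (hq : q = ∏ l ∈ s, (X - C (z l)))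
    {F : ℕ → ℝ} (hF : ∀ k, F k = ∑ l ∈ s, 1 / (x - z l) ^ k) :
    (derivative q).eval x = q.eval x * F 1 ∧
    (derivative (derivative q)).eval x = q.eval x * (F 1 ^ 2 - F 2) ∧
    (derivative (derivative (derivative q))).eval x =
      q.eval x * (F 1 ^ 3 - 3 * F 1 * F 2 + 2 * F 3) ∧
    (derivative (derivative (derivative (derivative q)))).eval x =
      q.eval x * (F 1 ^ 4 - 6 * F 1 ^ 2 * F 2 + 3 * F 2 ^ 2 + 8 * F 1 * F 3 - 6 * F 4) := by
  classical
  induction s using Finset.induction_on generalizing q F with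
  | empty => subst hq; simp [hF]
  | insert i s hi ih =>
    have hxi : x - z i ≠ 0 := hx i (Finset.mem_insert_self i s)
    obtain ⟨h1, h2, h3, h4⟩ := ih (fun l hl => hx l (Finset.mem_insert_of_mem hl)) rfl fun k => rfl
    rw [Finset.prod_insert hi] at hq
    simp only [Finset.sum_insert hi] at hF
    subst hq
    simp only [derivative_mul, derivative_add, derivative_sub, derivative_X, derivative_C,
      sub_zero, one_mul, eval_add, eval_mul, eval_sub, eval_X, eval_C, h1, h2, h3, h4, hF]
    refine ⟨?_, ?_, ?_, ?_⟩ <;> field_simp <;> ring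

/-- Antisymmetrization of a double sum over distinct nodes. -/
lemma two_mul_sum_mul_sum_erase {ι : Type*} [Fintype ι] [DecidableEq ι] (z g : ι → ℝ) :
    2 * ∑ i, g i * ∑ l ∈ Finset.univ.erase i, 1 / (z i - z l) =
      ∑ i, ∑ l ∈ Finset.univ.erase i, (g i - g l) / (z i - z l) := by
  have hswap : ∑ i, ∑ l ∈ Finset.univ.erase i, g i / (z i - z l) =
      ∑ i, ∑ l ∈ Finset.univ.erase i, -(g l / (z i - z l)) := by
    rw [Finset.sum_comm' (t' := Finset.univ) (s' := fun l => Finset.univ.erase l)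
      (by intro x y; simp [eq_comm])]
    refine Finset.sum_congr rfl fun i _ => Finset.sum_congr rfl fun l _ => ?_
    rw [← neg_sub (z i), div_neg]
  simp only [Finset.sum_neg_distrib] at hswap
  simp only [Finset.mul_sum (s := Finset.univ.erase _), mul_one_div, sub_div,
    Finset.sum_sub_distrib]
  linear_combination hswap

/-- Power sums of nodes that satisfy the Stieltjes relations of the Laguerre roots. -/
lemma power_sums_of_stieltjes {ν : ℝ} (hν : 0 < ν) {N : ℕ} {z : Fin N → ℝ}
    (hz : Function.Injective z) (hz0 : ∀ i, z i ≠ 0)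
    (hS : ∀ i, 2 * ∑ l ∈ Finset.univ.erase i, 1 / (z i - z l) = 1 - ν / z i) :
    ∑ i, z i = N * (N - 1 + ν) ∧
    ∑ i, z i ^ 2 = (2 * (N - 1) + ν) * (N * (N - 1 + ν)) ∧
    ∑ i, 1 / z i = N / ν ∧
    ∑ i, 1 / z i ^ 2 = N * (N + ν) / (ν ^ 2 * (ν + 1)) := by
  have hne : ∀ i, ∀ l ∈ Finset.univ.erase i, z i - z l ≠ 0 := fun i l hl =>
    sub_ne_zero.mpr fun h => Finset.ne_of_mem_erase hl (hz h).symm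
  have key : ∀ g : Fin N → ℝ, ∑ i, g i * (1 - ν / z i) =
      ∑ i, ∑ l ∈ Finset.univ.erase i, (g i - g l) / (z i - z l) := by
    intro g
    rw [← two_mul_sum_mul_sum_erase, Finset.mul_sum]
    exact Finset.sum_congr rfl fun i _ => by rw [← hS]; ring
  have hcard : ∀ i : Fin N, ((Finset.univ.erase i).card : ℝ) = N - 1 := by
    intro i
    rw [Finset.cast_card_erase_of_mem (Finset.mem_univ i)]
    simp
  have herase : ∀ (f : Fin N → ℝ) (i : Fin N),
      ∑ l ∈ Finset.univ.erase i, f l = ∑ l, f l - f i := fun f i => by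
    rw [← Finset.sum_erase_add _ _ (Finset.mem_univ i), add_sub_cancel_right]
  have h0 : (N : ℝ) - ν * ∑ i, 1 / z i = 0 := by
    have h := key fun _ => 1
    simp only [sub_self, zero_div, Finset.sum_const_zero, one_mul, Finset.sum_sub_distrib] at h
    rw [← h, Finset.mul_sum]
    simp [div_eq_mul_inv]
  have h1 : ∑ i, z i - N * ν = N * (N - 1) := by
    have h := key z
    have e1 : ∀ i, z i * (1 - ν / z i) = z i - ν := fun i => by
      have := hz0 i
      field_simp
    have e2 : ∀ i, ∑ l ∈ Finset.univ.erase i, (z i - z l) / (z i - z l) = (N : ℝ) - 1 := fun i => by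
      rw [Finset.sum_congr rfl fun l hl => div_self (hne i l hl)]
      rw [Finset.sum_const, nsmul_eq_mul, hcard, mul_one]
    simp only [e1, e2, Finset.sum_sub_distrib, Finset.sum_const, Finset.card_univ,
      Fintype.card_fin, nsmul_eq_mul] at h
    linear_combination h
  have h2 : ∑ i, z i ^ 2 - ν * ∑ i, z i = 2 * (N - 1) * ∑ i, z i := by
    have h := key fun i => z i ^ 2
    have e1 : ∀ i, z i ^ 2 * (1 - ν / z i) = z i ^ 2 - ν * z i := fun i => by
      have := hz0 i
      field_simp
    have e2 : ∀ i, ∑ l ∈ Finset.univ.erase i, (z i ^ 2 - z l ^ 2) / (z i - z l) =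
        (N - 2) * z i + ∑ l, z l := fun i => by
      rw [Finset.sum_congr rfl fun l hl => show (z i ^ 2 - z l ^ 2) / (z i - z l) = z i + z l by
        have := hne i l hl
        field_simp
        ring]
      rw [Finset.sum_add_distrib, herase z, Finset.sum_const, nsmul_eq_mul, hcard]
      ring
    simp only [e1, e2, Finset.sum_sub_distrib, Finset.sum_add_distrib, Finset.sum_const,
      Finset.card_univ, Fintype.card_fin, nsmul_eq_mul, ← Finset.mul_sum] at h
    linear_combination h
  have h3 : ∑ i, 1 / z i - ν * ∑ i, 1 / z i ^ 2 =
      ∑ i, 1 / z i ^ 2 - (∑ i, 1 / z i) ^ 2 := by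
    have h := key fun i => 1 / z i
    have e1 : ∀ i, 1 / z i * (1 - ν / z i) = 1 / z i - ν * (1 / z i ^ 2) := fun i => by
      have := hz0 i
      field_simp
    have e2 : ∀ i, ∑ l ∈ Finset.univ.erase i, (1 / z i - 1 / z l) / (z i - z l) =
        1 / z i ^ 2 - 1 / z i * ∑ l, 1 / z l := fun i => by
      rw [Finset.sum_congr rfl fun l hl => show (1 / z i - 1 / z l) / (z i - z l) =
          -(1 / z i) * (1 / z l) by
        have := hne i l hl
        have := hz0 i
        have := hz0 l
        field_simp
        ring]
      rw [← Finset.mul_sum, herase]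
      ring
    simp only [e1, e2, Finset.sum_sub_distrib, ← Finset.mul_sum, ← Finset.sum_mul] at h
    linear_combination h
  have h0' : ∑ i, 1 / z i = N / ν := by
    field_simp
    linear_combination -h0
  have h1' : ∑ i, z i = N * (N - 1 + ν) := by linear_combination h1
  refine ⟨h1', ?_, h0', ?_⟩
  · rw [h1'] at h2
    linear_combination h2
  · rw [h0'] at h3
    have : ν + 1 ≠ 0 := by positivity
    field_simp at h3 ⊢
    linear_combination -h3

/-- Reciprocal power sums of the differences at a node `z i`, for a monic polynomial with simple
roots that solves Laguerre's equation. -/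
lemma reciprocal_sums_of_ode {ν n : ℝ} {ι : Type*} [Fintype ι] [DecidableEq ι] {z : ι → ℝ}
    (hz : Function.Injective z) {i : ι} {P : ℝ[X]} (hP : P = ∏ l, (X - C (z l)))
    (hode : X * derivative (derivative P) + (C ν - X) * derivative P + C n * P = 0)
    {F : ℕ → ℝ} (hF : ∀ k, F k = ∑ l ∈ Finset.univ.erase i, 1 / (z i - z l) ^ k) :
    2 * z i * F 1 + (ν - z i) = 0 ∧
    3 * z i * (F 1 ^ 2 - F 2) + (1 + ν - z i) * 2 * F 1 + (n - 1) = 0 ∧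
    4 * z i * (F 1 ^ 3 - 3 * F 1 * F 2 + 2 * F 3)
      + (2 + ν - z i) * 3 * (F 1 ^ 2 - F 2) + (n - 2) * 2 * F 1 = 0 ∧
    5 * z i * (F 1 ^ 4 - 6 * F 1 ^ 2 * F 2 + 3 * F 2 ^ 2 + 8 * F 1 * F 3 - 6 * F 4)
      + (3 + ν - z i) * 4 * (F 1 ^ 3 - 3 * F 1 * F 2 + 2 * F 3)
      + (n - 3) * 3 * (F 1 ^ 2 - F 2) = 0 := by
  have hne : ∀ l ∈ Finset.univ.erase i, z i - z l ≠ 0 := fun l hl =>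
    sub_ne_zero.mpr fun h => Finset.ne_of_mem_erase hl (hz h).symm
  obtain ⟨q, hq⟩ : ∃ q : ℝ[X], q = ∏ l ∈ Finset.univ.erase i, (X - C (z l)) := ⟨_, rfl⟩
  obtain ⟨h1, h2, h3, h4⟩ := derivatives_prod_X_sub_C _ z (z i) hne hq hF
  have hq0 : q.eval (z i) ≠ 0 := by
    rw [hq, eval_prod]
    exact Finset.prod_ne_zero_iff.mpr fun l hl => by simpa using hne l hl
  rw [← Finset.mul_prod_erase _ _ (Finset.mem_univ i), ← hq] at hP
  subst hP
  have hode1 := congrArg derivative hode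
  have hode2 := congrArg derivative hode1
  have hode3 := congrArg derivative hode2
  replace hode := congrArg (eval (z i)) hode
  replace hode1 := congrArg (eval (z i)) hode1
  replace hode2 := congrArg (eval (z i)) hode2
  replace hode3 := congrArg (eval (z i)) hode3
  simp only [derivative_mul, derivative_add, derivative_sub, derivative_X, derivative_C,
    derivative_one, derivative_zero, sub_zero, one_mul, zero_mul, zero_add, add_zero, eval_add,
    eval_mul, eval_sub, eval_X, eval_C, sub_self, zero_sub, eval_neg, eval_one, eval_zero,
    derivative_neg, h1, h2, h3, h4] at hode hode1 hode2 hode3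
  refine ⟨?_, ?_, ?_, ?_⟩ <;> apply mul_left_cancel₀ hq0
  · linear_combination hode
  · linear_combination hode1
  · linear_combination hode2
  · linear_combination hode3

/-- The summand of the trace identity as a Laurent polynomial in the root. -/
lemma summand_eq_laurent {ν n x F₁ F₂ F₃ F₄ : ℝ} (hx : x ≠ 0)
    (h1 : 2 * x * F₁ + (ν - x) = 0)
    (h2 : 3 * x * (F₁ ^ 2 - F₂) + (1 + ν - x) * 2 * F₁ + (n - 1) = 0)
    (h3 : 4 * x * (F₁ ^ 3 - 3 * F₁ * F₂ + 2 * F₃)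
      + (2 + ν - x) * 3 * (F₁ ^ 2 - F₂) + (n - 2) * 2 * F₁ = 0)
    (h4 : 5 * x * (F₁ ^ 4 - 6 * F₁ ^ 2 * F₂ + 3 * F₂ ^ 2 + 8 * F₁ * F₃ - 6 * F₄)
      + (3 + ν - x) * 4 * (F₁ ^ 3 - 3 * F₁ * F₂ + 2 * F₃)
      + (n - 3) * 3 * (F₁ ^ 2 - F₂) = 0) :
    (ν / x + 2 * (2 * x * F₂ - F₁)) ^ 2 + 16 * (x ^ 2 * F₄ - x * F₃) =
      2 / 15 * ν * (ν + 1) * (ν - 2) * (ν - 3) * (1 / x ^ 2)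
      + (-12 * n - 26 * ν + 32 * ν * n + 26 * ν ^ 2 - 16 * ν ^ 2 * n - 8 * ν ^ 3) / 15 * (1 / x)
      + (15 - 40 * n + 32 * n ^ 2 - 28 * ν + 32 * ν * n + 12 * ν ^ 2) / 15
      + (10 - 16 * n - 8 * ν) / 15 * x + 2 / 15 * x ^ 2 := by
  have e1 : F₁ = (x - ν) / (2 * x) := by
    field_simp
    linear_combination h1
  have e2 : F₂ = F₁ ^ 2 + ((1 + ν - x) * 2 * F₁ + (n - 1)) / (3 * x) := by
    field_simp
    linear_combination -h2
  have e3 : F₃ = -(F₁ ^ 3 - 3 * F₁ * F₂) / 2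
      - ((2 + ν - x) * 3 * (F₁ ^ 2 - F₂) + (n - 2) * 2 * F₁) / (8 * x) := by
    field_simp
    linear_combination 2 * h3
  have e4 : F₄ = (F₁ ^ 4 - 6 * F₁ ^ 2 * F₂ + 3 * F₂ ^ 2 + 8 * F₁ * F₃) / 6
      + ((3 + ν - x) * 4 * (F₁ ^ 3 - 3 * F₁ * F₂ + 2 * F₃)
        + (n - 3) * 3 * (F₁ ^ 2 - F₂)) / (30 * x) := by
    field_simp
    linear_combination -6 * h4
  rw [e4, e3, e2, e1]
  field_simp
  ring

/-- For the ordered roots `z 0 > … > z (N-1) > 0` of the Laguerre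
polynomial `L_N^{(ν-1)}` (`ν > 0`, `N ≥ 1`),
`∑_i [(ν/z i + 2·∑_{l ≠ i} (z i + z l)/(z i - z l)²)²
  + 16·∑_{l ≠ i} (z i · z l)/(z i - z l)⁴] = N(2N-1)(2N+1)/3`. -/
theorem laguerre_roots_trace_square_identity
    (ν : ℝ) (hν : 0 < ν) (N : ℕ) (hN : 1 ≤ N) (z : Fin N → ℝ)
    (hz : StrictAnti z) (hpos : ∀ i, 0 < z i)
    (hroot : ∀ i, (laguerreP (ν - 1) N).eval (z i) = 0) :
    ∑ i, ((ν / z i + 2 * ∑ l ∈ Finset.univ.erase i, (z i + z l) / (z i - z l) ^ 2) ^ 2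
        + 16 * ∑ l ∈ Finset.univ.erase i, (z i * z l) / (z i - z l) ^ 4)
      = (N : ℝ) * (2 * (N : ℝ) - 1) * (2 * (N : ℝ) + 1) / 3 := by
  have hinj := hz.injective
  have hz0 : ∀ i, z i ≠ 0 := fun i => (hpos i).ne'
  obtain ⟨c, hc, hprod⟩ := laguerreP_eq_C_mul_prod (by linarith) hinj hroot
  have hode := laguerreP_ode (ν - 1) N
  rw [add_sub_cancel, hprod] at hode
  replace hode : X * derivative (derivative (∏ l, (X - C (z l))))
      + (C ν - X) * derivative (∏ l, (X - C (z l))) + C (N : ℝ) * ∏ l, (X - C (z l)) = 0 := by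
    apply mul_left_cancel₀ (C_ne_zero.mpr hc)
    simp only [derivative_C_mul] at hode
    linear_combination hode
  have hrel := fun i => reciprocal_sums_of_ode (i := i) hinj rfl hode fun k => rfl
  obtain ⟨p1, p2, m1, m2⟩ := power_sums_of_stieltjes hν hinj hz0 fun i => by
    have h := (hrel i).1
    have := hz0 i
    simp only [pow_one] at h
    rw [eq_sub_iff_add_eq, ← mul_right_inj' this]
    rw [mul_add, mul_div_cancel₀ _ this]
    linear_combination h
  have hterm : ∀ i, (ν / z i + 2 * ∑ l ∈ Finset.univ.erase i, (z i + z l) / (z i - z l) ^ 2) ^ 2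
      + 16 * ∑ l ∈ Finset.univ.erase i, (z i * z l) / (z i - z l) ^ 4 =
      (ν / z i + 2 * (2 * z i * ∑ l ∈ Finset.univ.erase i, 1 / (z i - z l) ^ 2
        - ∑ l ∈ Finset.univ.erase i, 1 / (z i - z l) ^ 1)) ^ 2
      + 16 * (z i ^ 2 * ∑ l ∈ Finset.univ.erase i, 1 / (z i - z l) ^ 4
        - z i * ∑ l ∈ Finset.univ.erase i, 1 / (z i - z l) ^ 3) := fun i => by
    have hne : ∀ l ∈ Finset.univ.erase i, z i - z l ≠ 0 := fun l hl =>
      sub_ne_zero.mpr fun h => Finset.ne_of_mem_erase hl (hinj h).symm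
    simp only [Finset.mul_sum (s := Finset.univ.erase _), ← Finset.sum_sub_distrib]
    refine congrArg₂ (fun s t => (ν / z i + s) ^ 2 + t)
      (Finset.sum_congr rfl fun l hl => ?_) (Finset.sum_congr rfl fun l hl => ?_)
    · have := hne l hl
      field_simp
      ring
    · have := hne l hl
      field_simp
      ring
  rw [Finset.sum_congr rfl fun i _ => (hterm i).trans (summand_eq_laurent (hz0 i)
    (hrel i).1 (hrel i).2.1 (hrel i).2.2.1 (hrel i).2.2.2)]
  simp only [Finset.sum_add_distrib, ← Finset.mul_sum, p1, p2, m1, m2, Finset.sum_const,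
    Finset.card_univ, Fintype.card_fin, nsmul_eq_mul]
  have : ν + 1 ≠ 0 := by positivity
  field_simp
  ring
end
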